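/- Let n ≥ 1 and m ≥ 1 be integers, let g : ℝ^n → ℝ and f : ℝ → ℝ be infinitely differentiable, and suppose {B_1,…,B_m} is a partition of {1,…,n} with |B_l| = d_l (so ∑_{l=1}^m d_l = n) such that: (i) for all i ≠ j and all indices k_1 ∈ B_i, k_2 ∈ B_j, the second mixed partial ∂²g/∂x_{k_1}∂x_{k_2} vanishes identically; and (ii) for every l ∈ {1,…,m} there exist infinitely differentiable functions h_{l1} : ℝ → ℝ and h_{l2} : ℝ^n → ℝ such that for every nonempty subset B ⊆ B_l, the mixed partial derivative of g with respect to the coordinates in B equals h_{l1}^{(|B|)}(h_{l2}(x)) · ∏_{i ∈ B} ∂h_{l2}(x)/∂x_i. Then the order-n mixed partial derivative of f ∘ g with respect to all n coordinates equals ( ∏_{l=1}^m ∏_{i ∈ B_l} ∂h_{l2}(x)/∂x_i ) · ∑_{k=1}^{n} f^{(k)}(g(x)) · ∑_{j ∈ Q^{m}_{(d_1,…,d_m),k}} ∏_{l=1}^{m} B_{d_l,j_l}( h_{l1}′(h_{l2}(x)), …, h_{l1}^{(d_l−j_l+1)}(h_{l2}(x)) ). -/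

import Mathlib

noncomputable section

/-- Stirling numbers of the first kind `s(n,k)` (signed), real-valued,
defined by the recurrence `s(n+1,k) = s(n,k-1) - n·s(n,k)`. -/
def st1 : ℕ → ℕ → ℝ
  | 0, 0 => 1
  | 0, _ + 1 => 0
  | _ + 1, 0 => 0
  | n + 1, k + 1 => st1 n k - (n : ℝ) * st1 n (k + 1)

/-- Stirling numbers of the second kind `S(n,k)`, real-valued,
defined by the recurrence `S(n+1,k) = S(n,k-1) + k·S(n,k)`. -/
def st2 : ℕ → ℕ → ℝ
  | 0, 0 => 1
  | 0, _ + 1 => 0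
  | _ + 1, 0 => 0
  | n + 1, k + 1 => st2 n k + ((k : ℝ) + 1) * st2 n (k + 1)

/-- `snk n k x = ∑_{l=k}^n s(n,l) S(l,k) x^l`. -/
def snk (n k : ℕ) (x : ℝ) : ℝ := ∑ l ∈ Finset.Icc k n, st1 n l * st2 l k * x ^ l

/-- Falling factorial `(x)_n = x (x-1) ⋯ (x-n+1)`, with `(x)_0 = 1`. -/
def ff (x : ℝ) (n : ℕ) : ℝ := ∏ i ∈ Finset.range n, (x - (i : ℝ))

/-- The index set `P_{n,k}`: tuples `(j_1, …, j_{n-k+1})`, 0-indexed by `Fin (n-k+1)`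
(entry `i` representing `j_{i+1}`), with `∑ i·j_i = n` and `∑ j_i = k`. -/
def PIdx (n k : ℕ) : Finset (Fin (n - k + 1) → ℕ) :=
  (Fintype.piFinset fun _ => Finset.range (n + 1)).filter fun j =>
    (∑ i, (i.1 + 1) * j i) = n ∧ (∑ i, j i) = k

/-- The partial Bell polynomial `B_{n,k}(x_1,…,x_{n-k+1})`, the `l`-th argument being `x l`. -/
def bellP (n k : ℕ) (x : ℕ → ℝ) : ℝ :=
  ∑ j ∈ PIdx n k,
    ((n.factorial : ℝ) / ∏ i, ((j i).factorial : ℝ)) *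
      ∏ i, (x (i.1 + 1) / ((i.1 + 1).factorial : ℝ)) ^ j i

/-- The index set `Q^{d₀}_{d,k} = { j : ∑ j_s = k, 1 ≤ j_s ≤ d_s }`. -/
def QIdx (d0 : ℕ) (dv : Fin d0 → ℕ) (k : ℕ) : Finset (Fin d0 → ℕ) :=
  (Fintype.piFinset fun s => Finset.Icc 1 (dv s)).filter fun j => (∑ s, j s) = k

/-- Complete monotonicity of `h` on `(0,∞)`: `h` is infinitely differentiable there and
`(-1)^k h^{(k)}(t) ≥ 0` for all `k ∈ ℕ₀` and `t ∈ (0,∞)`. -/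
def CMOn (h : ℝ → ℝ) : Prop :=
  ContDiffOn ℝ (⊤ : ℕ∞) h (Set.Ioi 0) ∧
    ∀ k : ℕ, ∀ t ∈ Set.Ioi (0 : ℝ), 0 ≤ (-1 : ℝ) ^ k * iteratedDerivWithin k h (Set.Ioi 0) t

/-- Partial derivative of `F : ℝ^ι → ℝ` in the coordinate `i`. -/
def pdrv {ι : Type*} [DecidableEq ι] (i : ι) (F : (ι → ℝ) → ℝ) : (ι → ℝ) → ℝ :=
  fun x => deriv (fun y => F (Function.update x i y)) (x i)

/-! ### Partial derivatives of smooth functions -/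

theorem aux_pdrv_eq {n : ℕ} (i : Fin n) (F : (Fin n → ℝ) → ℝ) (hF : ContDiff ℝ (⊤ : ℕ∞) F) :
    pdrv i F = fun x => fderiv ℝ F x (Pi.single i 1) := by
  funext x
  have h1 : HasFDerivAt F (fderiv ℝ F x) (Function.update x i (x i)) := by
    rw [Function.update_eq_self]
    exact (hF.differentiable (by simp) x).hasFDerivAt
  exact (h1.comp_hasDerivAt (x i) (hasDerivAt_update x i (x i))).deriv

theorem aux_pdrv_smooth {n : ℕ} (i : Fin n) (F : (Fin n → ℝ) → ℝ) (hF : ContDiff ℝ (⊤ : ℕ∞) F) :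
    ContDiff ℝ (⊤ : ℕ∞) (pdrv i F) := by
  rw [aux_pdrv_eq i F hF]
  exact (hF.fderiv_right (m := (⊤ : ℕ∞)) (by simp)).clm_apply contDiff_const

theorem aux_pdrv_comm {n : ℕ} (i j : Fin n) (F : (Fin n → ℝ) → ℝ)
    (hF : ContDiff ℝ (⊤ : ℕ∞) F) : pdrv i (pdrv j F) = pdrv j (pdrv i F) := by
  have key : ∀ i j : Fin n, ∀ x, pdrv i (pdrv j F) x =
      fderiv ℝ (fderiv ℝ F) x (Pi.single i 1) (Pi.single j 1) := by
    intro i j x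
    rw [aux_pdrv_eq i _ (aux_pdrv_smooth j F hF), aux_pdrv_eq j F hF]
    have hd : DifferentiableAt ℝ (fderiv ℝ F) x :=
      (hF.fderiv_right (m := (⊤ : ℕ∞)) (by simp)).differentiable (by simp) x
    have := (hd.hasFDerivAt.clm_apply (hasFDerivAt_const (Pi.single j (1 : ℝ)) x)).fderiv
    simp [this]
  funext x
  rw [key, key]
  have hs : IsSymmSndFDerivAt ℝ F x :=
    (hF.contDiffAt (x := x)).isSymmSndFDerivAt (by simp; exact WithTop.coe_le_coe.2 le_top)
  exact hs _ _

theorem aux_pdrv_mul {n : ℕ} (i : Fin n) (u v : (Fin n → ℝ) → ℝ)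
    (hu : ContDiff ℝ (⊤ : ℕ∞) u) (hv : ContDiff ℝ (⊤ : ℕ∞) v) :
    pdrv i (fun x => u x * v x) = fun x => pdrv i u x * v x + u x * pdrv i v x := by
  rw [aux_pdrv_eq i _ (hu.mul hv), aux_pdrv_eq i u hu, aux_pdrv_eq i v hv]
  funext x
  have := ((hu.differentiable (by simp) x).hasFDerivAt.mul
    (hv.differentiable (by simp) x).hasFDerivAt).fderiv
  simp only [Pi.mul_def] at this
  rw [this]
  simp
  ring

theorem aux_pdrv_sum {n : ℕ} {ι : Type*} (s : Finset ι) (i : Fin n) (u : ι → (Fin n → ℝ) → ℝ)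
    (hu : ∀ a, ContDiff ℝ (⊤ : ℕ∞) (u a)) :
    pdrv i (fun x => ∑ a ∈ s, u a x) = fun x => ∑ a ∈ s, pdrv i (u a) x := by
  rw [aux_pdrv_eq i _ (ContDiff.sum fun a _ => hu a)]
  funext x
  rw [fderiv_fun_sum fun a _ => (hu a).differentiable (by simp) x]
  simp only [sum_apply]
  exact Finset.sum_congr rfl fun a _ => by rw [aux_pdrv_eq i _ (hu a)]

theorem aux_pdrv_comp {n : ℕ} (i : Fin n) (f : ℝ → ℝ) (g : (Fin n → ℝ) → ℝ)
    (hf : ContDiff ℝ (⊤ : ℕ∞) f) (hg : ContDiff ℝ (⊤ : ℕ∞) g) :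
    pdrv i (fun x => f (g x)) = fun x => deriv f (g x) * pdrv i g x := by
  rw [aux_pdrv_eq i (fun x => f (g x)) (hf.comp hg), aux_pdrv_eq i g hg]
  funext x
  have := ((hf.differentiable (by simp) (g x)).hasDerivAt.comp_hasFDerivAt x
    (hg.differentiable (by simp) x).hasFDerivAt).fderiv
  simp only [Function.comp_def] at this
  rw [this]
  simp

theorem aux_pdrv_zero {n : ℕ} (i : Fin n) : pdrv i (0 : (Fin n → ℝ) → ℝ) = 0 := by
  funext x
  simp [pdrv]

theorem aux_foldr_zero {n : ℕ} (L : List (Fin n)) :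
    L.foldr pdrv (0 : (Fin n → ℝ) → ℝ) = 0 := by
  induction L with
  | nil => rfl
  | cons a L ih => rw [List.foldr_cons, ih, aux_pdrv_zero]

theorem aux_foldr_smooth {n : ℕ} (L : List (Fin n)) (F : (Fin n → ℝ) → ℝ)
    (hF : ContDiff ℝ (⊤ : ℕ∞) F) : ContDiff ℝ (⊤ : ℕ∞) (L.foldr pdrv F) := by
  induction L with
  | nil => exact hF
  | cons a L ih => exact aux_pdrv_smooth _ _ ih

theorem aux_foldr_perm {n : ℕ} {L L' : List (Fin n)} (h : L.Perm L') (F : (Fin n → ℝ) → ℝ)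
    (hF : ContDiff ℝ (⊤ : ℕ∞) F) : L.foldr pdrv F = L'.foldr pdrv F := by
  induction h with
  | nil => rfl
  | cons a _ ih => rw [List.foldr_cons, ih, List.foldr_cons]
  | swap a b l =>
    simp only [List.foldr_cons]
    exact aux_pdrv_comm _ _ _ (aux_foldr_smooth l F hF)
  | trans _ _ ih1 ih2 => exact ih1.trans ih2

/-- Mixed partial derivative with respect to the coordinates in `S`. -/
def auxD {n : ℕ} (S : Finset (Fin n)) (F : (Fin n → ℝ) → ℝ) : (Fin n → ℝ) → ℝ :=
  S.toList.foldr pdrv F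

theorem aux_D_list {n : ℕ} (L : List (Fin n)) (hL : L.Nodup) (S : Finset (Fin n))
    (hS : ∀ i, i ∈ L ↔ i ∈ S) (F : (Fin n → ℝ) → ℝ) (hF : ContDiff ℝ (⊤ : ℕ∞) F) :
    L.foldr pdrv F = auxD S F := by
  refine aux_foldr_perm ?_ F hF
  rw [List.perm_ext_iff_of_nodup hL S.nodup_toList]
  simpa using hS

theorem aux_D_empty {n : ℕ} (F : (Fin n → ℝ) → ℝ) : auxD (∅ : Finset (Fin n)) F = F := by
  simp [auxD]

theorem aux_D_smooth {n : ℕ} (S : Finset (Fin n)) (F : (Fin n → ℝ) → ℝ)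
    (hF : ContDiff ℝ (⊤ : ℕ∞) F) : ContDiff ℝ (⊤ : ℕ∞) (auxD S F) :=
  aux_foldr_smooth _ F hF

theorem aux_D_insert {n : ℕ} (i : Fin n) (S : Finset (Fin n)) (hi : i ∉ S)
    (F : (Fin n → ℝ) → ℝ) (hF : ContDiff ℝ (⊤ : ℕ∞) F) :
    auxD (insert i S) F = pdrv i (auxD S F) := by
  rw [← aux_D_list (i :: S.toList) (by simp [hi, S.nodup_toList]) (insert i S) (by simp) F hF]
  rfl

theorem aux_D_insert' {n : ℕ} (i : Fin n) (S : Finset (Fin n)) (hi : i ∉ S)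
    (F : (Fin n → ℝ) → ℝ) (hF : ContDiff ℝ (⊤ : ℕ∞) F) :
    auxD (insert i S) F = auxD S (pdrv i F) := by
  rw [← aux_D_list (S.toList ++ [i]) (by
    rw [List.nodup_append]; simp [S.nodup_toList, hi])
    (insert i S) (by simp; tauto) F hF]
  rw [List.foldr_append]
  rfl

theorem aux_D_mul {n : ℕ} (S : Finset (Fin n)) (u v : (Fin n → ℝ) → ℝ)
    (hu : ContDiff ℝ (⊤ : ℕ∞) u) (hv : ContDiff ℝ (⊤ : ℕ∞) v) :
    auxD S (fun x => u x * v x) =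
      fun x => ∑ C ∈ S.powerset, auxD (S \ C) u x * auxD C v x := by
  induction S using Finset.induction_on with
  | empty => simp [aux_D_empty]
  | insert i S hi ih =>
    rw [aux_D_insert i S hi _ (hu.mul hv), ih, aux_pdrv_sum _ _ _
      (fun C => (aux_D_smooth _ u hu).mul (aux_D_smooth _ v hv))]
    funext x
    rw [Finset.sum_powerset_insert hi, ← Finset.sum_add_distrib]
    refine Finset.sum_congr rfl fun C hC => ?_
    have hC' := Finset.mem_powerset.1 hC
    have hiC : i ∉ C := fun h => hi (hC' h)
    rw [aux_pdrv_mul _ _ _ (aux_D_smooth _ u hu) (aux_D_smooth _ v hv),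
      Finset.insert_sdiff_of_notMem _ hiC, aux_D_insert i (S \ C) (by simp [hi]) u hu,
      aux_D_insert i C hiC v hv]
    have : insert i S \ insert i C = S \ C := by
      ext a; simp only [Finset.mem_sdiff, Finset.mem_insert]
      constructor
      · tauto
      · rintro ⟨h1, h2⟩
        refine ⟨Or.inr h1, ?_⟩
        rintro (rfl | h)
        · exact hi h1
        · exact h2 h
    rw [this]

/-! ### Bell polynomials -/

/-- Complete Bell polynomials with a marking variable, by recursion. -/
def auxY (x : ℕ → ℝ) : ℕ → Polynomial ℝ
  | 0 => 1
  | d + 1 => Polynomial.X * ∑ r : Fin (d + 1),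
      Polynomial.C ((d.choose r.1 : ℝ) * x (r.1 + 1)) * auxY x (d - r.1)
  decreasing_by omega

theorem aux_Y_succ (x : ℕ → ℝ) (d : ℕ) : auxY x (d + 1) =
    Polynomial.X * ∑ r ∈ Finset.range (d + 1),
      Polynomial.C ((d.choose r : ℝ) * x (r + 1)) * auxY x (d - r) := by
  rw [auxY, Finset.sum_range]

/-- The exponential generating function of `x_1, x_2, …`, divided by the variable. -/
def auxPhi (x : ℕ → ℝ) : PowerSeries ℝ :=
  PowerSeries.mk fun i => x (i + 1) / ((i + 1).factorial : ℝ)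

theorem aux_Y_coeff (x : ℕ → ℝ) (d k : ℕ) : (auxY x d).coeff k =
    (d.factorial : ℝ) / (k.factorial : ℝ) *
      PowerSeries.coeff d ((PowerSeries.X * auxPhi x) ^ k) := by
  induction d using Nat.strong_induction_on generalizing k with
  | _ d ih =>
  cases d with
  | zero =>
    rw [auxY]
    cases k with
    | zero => simp
    | succ k => simp [Polynomial.coeff_one]
  | succ d =>
    rw [aux_Y_succ]
    cases k with
    | zero => simp [PowerSeries.coeff_one]
    | succ k =>
      rw [Polynomial.coeff_X_mul, Polynomial.finsetSum_coeff]
      have hder := PowerSeries.coeff_derivative ((PowerSeries.X * auxPhi x) ^ (k + 1)) d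
      rw [PowerSeries.derivative_pow] at hder
      have h1 : ∀ r, PowerSeries.coeff r (PowerSeries.derivative ℝ (PowerSeries.X * auxPhi x)) =
          x (r + 1) / (r.factorial : ℝ) := by
        intro r
        rw [PowerSeries.coeff_derivative, PowerSeries.coeff_succ_X_mul, auxPhi,
          PowerSeries.coeff_mk, Nat.factorial_succ]
        have : (r.factorial : ℝ) ≠ 0 := by positivity
        push_cast
        field_simp
      have h2 : PowerSeries.coeff d (((k + 1 : ℕ) : PowerSeries ℝ) *
          (PowerSeries.X * auxPhi x) ^ (k + 1 - 1) *
          PowerSeries.derivative ℝ (PowerSeries.X * auxPhi x)) =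
          ((k : ℝ) + 1) * ∑ r ∈ Finset.range (d + 1), x (r + 1) / (r.factorial : ℝ) *
            PowerSeries.coeff (d - r) ((PowerSeries.X * auxPhi x) ^ k) := by
        rw [mul_assoc, mul_comm (_ ^ _), Nat.add_sub_cancel]
        have : ((k + 1 : ℕ) : PowerSeries ℝ) = PowerSeries.C ((k : ℝ) + 1) := by simp
        rw [this, PowerSeries.coeff_C_mul, PowerSeries.coeff_mul,
          Finset.Nat.sum_antidiagonal_eq_sum_range_succ_mk]
        simp only [h1]
      rw [h2] at hder
      have h3 : PowerSeries.coeff (d + 1) ((PowerSeries.X * auxPhi x) ^ (k + 1)) =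
        (((k : ℝ) + 1) * ∑ r ∈ Finset.range (d + 1), x (r + 1) / (r.factorial : ℝ) *
            PowerSeries.coeff (d - r) ((PowerSeries.X * auxPhi x) ^ k)) / ((d : ℝ) + 1) := by
        rw [hder]
        field_simp
      rw [h3]
      have h4 : ∀ A : ℝ, ((d + 1).factorial : ℝ) / ((k + 1).factorial : ℝ) *
          (((k : ℝ) + 1) * A / ((d : ℝ) + 1)) = (d.factorial : ℝ) / (k.factorial : ℝ) * A := by
        intro A
        rw [Nat.factorial_succ, Nat.factorial_succ]
        push_cast
        have : (k.factorial : ℝ) ≠ 0 := by positivity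
        field_simp
      rw [h4, Finset.mul_sum]
      refine Finset.sum_congr rfl fun r hr => ?_
      have hr' : r ≤ d := by simpa [Nat.lt_succ_iff] using hr
      rw [Polynomial.coeff_C_mul, ih (d - r) (by omega), Nat.cast_choose ℝ hr']
      have e1 : (k.factorial : ℝ) ≠ 0 := by positivity
      have e2 : (r.factorial : ℝ) ≠ 0 := by positivity
      have e3 : ((d - r).factorial : ℝ) ≠ 0 := by positivity
      field_simp

theorem aux_bellP (x : ℕ → ℝ) (n k : ℕ) : bellP n k x =
    (n.factorial : ℝ) / (k.factorial : ℝ) *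
      PowerSeries.coeff n ((PowerSeries.X * auxPhi x) ^ k) := by
  rw [mul_pow, PowerSeries.coeff_X_pow_mul']
  split_ifs with hkn
  · have ht : PowerSeries.coeff (n - k) (auxPhi x ^ k) =
        (((PowerSeries.trunc (n - k + 1) (auxPhi x)) ^ k : Polynomial ℝ)).coeff (n - k) := by
      have h := congrArg (fun p : Polynomial ℝ => p.coeff (n - k))
        (PowerSeries.trunc_trunc_pow (auxPhi x) (n - k + 1) k)
      simp only [PowerSeries.coeff_trunc] at h
      rw [if_pos (by omega), if_pos (by omega)] at h
      rw [← h, ← Polynomial.coe_pow, Polynomial.coeff_coe]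
    have ht2 : PowerSeries.trunc (n - k + 1) (auxPhi x) = ∑ i : Fin (n - k + 1),
        Polynomial.monomial i.1 (x (i.1 + 1) / ((i.1 + 1).factorial : ℝ)) := by
      ext a
      rw [PowerSeries.coeff_trunc, Polynomial.finsetSum_coeff,
        Finset.sum_fin_eq_sum_range]
      simp only [Polynomial.coeff_monomial, auxPhi, PowerSeries.coeff_mk]
      split_ifs with ha
      · rw [Finset.sum_eq_single a]
        · simp [ha]
        · intro b _ hb
          simp [hb]
        · simp [ha]
      · symm
        refine Finset.sum_eq_zero fun b hb => ?_
        have : b < (n - k + 1) := Finset.mem_range.1 hb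
        rw [dif_pos this, if_neg (by omega)]
    rw [ht, ht2, Finset.sum_pow_eq_sum_piAntidiag, Polynomial.finsetSum_coeff, bellP,
      Finset.mul_sum]
    have hterm : ∀ j : Fin (n - k + 1) → ℕ, (((Nat.multinomial Finset.univ j : ℕ) : Polynomial ℝ) *
        ∏ i, (Polynomial.monomial i.1 (x (i.1 + 1) / ((i.1 + 1).factorial : ℝ))) ^ j i).coeff
          (n - k) = if ∑ i, i.1 * j i = n - k then (Nat.multinomial Finset.univ j : ℝ) *
            ∏ i, (x (i.1 + 1) / ((i.1 + 1).factorial : ℝ)) ^ j i else 0 := by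
      intro j
      have : ∏ i, (Polynomial.monomial i.1 (x (i.1 + 1) / ((i.1 + 1).factorial : ℝ))) ^ j i =
          Polynomial.monomial (∑ i : Fin (n - k + 1), i.1 * j i)
            (∏ i : Fin (n - k + 1), (x (i.1 + 1) / ((i.1 + 1).factorial : ℝ)) ^ j i) := by
        simp only [Polynomial.monomial_pow]
        induction (Finset.univ : Finset (Fin (n - k + 1))) using Finset.induction_on with
        | empty => simp
        | insert a s ha ih =>
          rw [Finset.prod_insert ha, ih, Polynomial.monomial_mul_monomial, Finset.sum_insert ha,
            Finset.prod_insert ha]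
      rw [this, Polynomial.coeff_natCast_mul, Polynomial.coeff_monomial]
      split_ifs <;> simp
    simp only [hterm]
    refine Finset.sum_subset_zero_on_sdiff ?_ ?_ ?_
    · intro j hj
      simp only [PIdx, Finset.mem_filter] at hj
      simp [Finset.mem_piAntidiag, hj.2.2]
    · intro j hj
      simp only [Finset.mem_sdiff, Finset.mem_piAntidiag, PIdx, Finset.mem_filter,
        Fintype.mem_piFinset, Finset.mem_range] at hj
      obtain ⟨⟨hj1, -⟩, hj2⟩ := hj
      replace hj1 : ∑ i, j i = k := hj1
      rw [if_neg, mul_zero]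
      intro hs
      refine hj2 ⟨fun i => ?_, ?_, hj1⟩
      · have := Finset.single_le_sum (f := j) (fun _ _ => Nat.zero_le _) (Finset.mem_univ i)
        omega
      · simp only [add_mul, one_mul, Finset.sum_add_distrib]
        omega
    · intro j hj
      simp only [PIdx, Finset.mem_filter] at hj
      obtain ⟨-, hj1, hj2⟩ := hj
      simp only [add_mul, one_mul, Finset.sum_add_distrib] at hj1
      rw [if_pos (by omega)]
      have hm : ((∏ i, (j i).factorial : ℕ) : ℝ) * (Nat.multinomial Finset.univ j : ℝ) =
          (k.factorial : ℝ) := by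
        rw [← Nat.cast_mul, Nat.multinomial_spec Finset.univ j, hj2]
      push_cast at hm
      have e1 : (k.factorial : ℝ) ≠ 0 := by positivity
      have e2 : (∏ i, ((j i).factorial : ℝ)) ≠ 0 := by positivity
      rw [← hm] at e1 ⊢
      have e3 := right_ne_zero_of_mul e1
      rw [← mul_assoc]
      congr 1
      field_simp
  · rw [mul_zero, bellP]
    refine Finset.sum_eq_zero fun j hj => ?_
    exfalso
    simp only [PIdx, Finset.mem_filter] at hj
    obtain ⟨-, hj1, hj2⟩ := hj
    simp only [add_mul, one_mul, Finset.sum_add_distrib] at hj1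
    omega

theorem aux_Y_eq (x : ℕ → ℝ) (d : ℕ) (hd : 1 ≤ d) : auxY x d =
    ∑ k ∈ Finset.Icc 1 d, Polynomial.monomial k (bellP d k x) := by
  ext k
  rw [Polynomial.finsetSum_coeff]
  simp only [Polynomial.coeff_monomial, Finset.sum_ite_eq', Finset.mem_Icc]
  rw [aux_Y_coeff, ← aux_bellP]
  split_ifs with h
  · rfl
  · rw [aux_bellP]
    have : k = 0 ∨ d < k := by omega
    rcases this with rfl | h
    · simp [PowerSeries.coeff_one]; omega
    · rw [mul_pow, PowerSeries.coeff_X_pow_mul', if_neg (by omega), mul_zero]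

/-! ### The umbral functional and the main induction -/

/-- The linear functional sending `X ^ k` to the `k`-th derivative of `f` at `y`. -/
def auxEv (f : ℝ → ℝ) (y : ℝ) : Polynomial ℝ →ₗ[ℝ] ℝ :=
  Polynomial.lsum fun k => LinearMap.toSpanSingleton ℝ ℝ (iteratedDeriv k f y)

theorem aux_Ev_monomial (f : ℝ → ℝ) (y : ℝ) (k : ℕ) (a : ℝ) :
    auxEv f y (Polynomial.monomial k a) = a * iteratedDeriv k f y := by
  simp [auxEv, Polynomial.sum_monomial_index]

theorem aux_Ev_deriv (f : ℝ → ℝ) (y : ℝ) (p : Polynomial ℝ) :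
    auxEv (deriv f) y p = auxEv f y (Polynomial.X * p) := by
  induction p using Polynomial.induction_on' with
  | add p q hp hq => rw [map_add, hp, hq, mul_add, map_add]
  | monomial k a =>
    rw [Polynomial.X_mul_monomial, aux_Ev_monomial, aux_Ev_monomial, iteratedDeriv_succ']

theorem aux_main {n m : ℕ} (g : (Fin n → ℝ) → ℝ) (hg : ContDiff ℝ (⊤ : ℕ∞) g)
    (B : Fin m → Finset (Fin n))
    (hBdisj : ∀ i j : Fin m, i ≠ j → Disjoint (B i) (B j))
    (p : Fin n → Fin m) (hp : ∀ i, i ∈ B (p i))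
    (x : Fin n → ℝ) (a : Fin n → ℝ) (w : Fin m → ℕ → ℝ)
    (hzero : ∀ S : Finset (Fin n), ∀ i ∈ S, ¬ S ⊆ B (p i) → auxD S g x = 0)
    (hfact : ∀ l : Fin m, ∀ S : Finset (Fin n), S ⊆ B l → S.Nonempty →
      auxD S g x = w l S.card * ∏ i ∈ S, a i)
    (N : ℕ) : ∀ S : Finset (Fin n), S.card = N → ∀ f : ℝ → ℝ, ContDiff ℝ (⊤ : ℕ∞) f →
      auxD S (fun y => f (g y)) x =
        (∏ i ∈ S, a i) * auxEv f (g x) (∏ l, auxY (w l) (S ∩ B l).card) := by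
  induction N using Nat.strong_induction_on with
  | _ N ih =>
  intro S hS f hf
  rcases S.eq_empty_or_nonempty with rfl | ⟨i, hiS⟩
  · have : auxEv f (g x) 1 = f (g x) := by
      have := aux_Ev_monomial f (g x) 0 1
      simpa using this
    simp [aux_D_empty, auxY, this]
  obtain ⟨T, hiT, rfl⟩ : ∃ T, i ∉ T ∧ insert i T = S :=
    ⟨S.erase i, Finset.notMem_erase i S, Finset.insert_erase hiS⟩
  rw [Finset.card_insert_of_notMem hiT] at hS
  have hf' : ContDiff ℝ (⊤ : ℕ∞) (deriv f) := by
    exact (contDiff_infty_iff_deriv.1 hf).2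
  have hfg : ContDiff ℝ (⊤ : ℕ∞) fun y => f (g y) := hf.comp hg
  have hfg' : ContDiff ℝ (⊤ : ℕ∞) fun y => deriv f (g y) := hf'.comp hg
  rw [aux_D_insert' i T hiT _ hfg, aux_pdrv_comp i f g hf hg,
    aux_D_mul T _ _ hfg' (aux_pdrv_smooth i g hg)]
  set l0 := p i with hl0
  have hi0 : i ∈ B l0 := hp i
  set R : Polynomial ℝ := ∏ l ∈ Finset.univ.erase l0, auxY (w l) (T ∩ B l).card with hR
  have hsub : (T ∩ B l0).powerset ⊆ T.powerset :=
    Finset.powerset_mono.2 Finset.inter_subset_left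
  have hother : ∀ l, l ≠ l0 → i ∉ B l := fun l hl h =>
    (Finset.disjoint_left.1 (hBdisj l l0 hl) h) hi0
  beta_reduce
  rw [← Finset.sum_subset hsub]
  · have hterm : ∀ C ∈ (T ∩ B l0).powerset,
        auxD (T \ C) (fun y => deriv f (g y)) x * auxD C (pdrv i g) x =
        (∏ i ∈ insert i T, a i) * (w l0 (C.card + 1) *
          auxEv f (g x) (Polynomial.X * (auxY (w l0) ((T ∩ B l0).card - C.card) * R))) := by
      intro C hC
      have hC' := Finset.mem_powerset.1 hC
      have hCT : C ⊆ T := hC'.trans Finset.inter_subset_left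
      have hCB : C ⊆ B l0 := hC'.trans Finset.inter_subset_right
      have hiC : i ∉ C := fun h => hiT (hCT h)
      rw [← aux_D_insert' i C hiC g hg,
        hfact l0 (insert i C) (Finset.insert_subset hi0 hCB) (Finset.insert_nonempty _ _),
        ih (T \ C).card (by have := Finset.card_le_card (Finset.sdiff_subset (s := T) (t := C))
                            omega) (T \ C) rfl (deriv f) hf',
        aux_Ev_deriv, ← Finset.mul_prod_erase _ _ (Finset.mem_univ l0)]
      have e1 : ((T \ C) ∩ B l0).card = (T ∩ B l0).card - C.card := by
        rw [← Finset.card_sdiff_of_subset hC']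
        congr 1
        ext b
        simp only [Finset.mem_inter, Finset.mem_sdiff]
        tauto
      have e2 : ∏ l ∈ Finset.univ.erase l0, auxY (w l) ((T \ C) ∩ B l).card = R := by
        refine Finset.prod_congr rfl fun l hl => ?_
        have hl' : l ≠ l0 := (Finset.mem_erase.1 hl).1
        congr 2
        ext b
        simp only [Finset.mem_inter, Finset.mem_sdiff]
        constructor
        · tauto
        · rintro ⟨h1, h2⟩
          exact ⟨⟨h1, fun h => (Finset.disjoint_left.1 (hBdisj l l0 hl') h2) (hCB h)⟩, h2⟩
      rw [e1, e2, Finset.card_insert_of_notMem hiC, Finset.prod_insert hiC,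
        Finset.prod_insert hiT, ← Finset.prod_sdiff hCT]
      ring
    rw [Finset.sum_congr rfl hterm, ← Finset.mul_sum,
      Finset.sum_powerset_apply_card (fun c => w l0 (c + 1) *
        auxEv f (g x) (Polynomial.X * (auxY (w l0) ((T ∩ B l0).card - c) * R))),
      ← Finset.mul_prod_erase _ _ (Finset.mem_univ l0)]
    congr 1
    have e3 : (insert i T ∩ B l0).card = (T ∩ B l0).card + 1 := by
      rw [Finset.insert_inter_of_mem hi0, Finset.card_insert_of_notMem (by simp [hiT])]
    have e4 : ∏ l ∈ Finset.univ.erase l0, auxY (w l) (insert i T ∩ B l).card = R := by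
      refine Finset.prod_congr rfl fun l hl => ?_
      rw [Finset.insert_inter_of_notMem (hother l (Finset.mem_erase.1 hl).1)]
    rw [e3, e4, aux_Y_succ, mul_assoc, Finset.sum_mul, Finset.mul_sum, map_sum]
    refine Finset.sum_congr rfl fun r _ => ?_
    rw [nsmul_eq_mul, ← mul_assoc, ← smul_eq_mul, ← map_smul, Polynomial.smul_eq_C_mul]
    congr 1
    ring
  · intro C hC hC2
    have hCT := Finset.mem_powerset.1 hC
    have hiC : i ∉ C := fun h => hiT (hCT h)
    rw [← aux_D_insert' i C hiC g hg, hzero (insert i C) i (Finset.mem_insert_self _ _), mul_zero]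
    intro h
    exact hC2 (Finset.mem_powerset.2 (Finset.subset_inter hCT
      ((Finset.subset_insert _ _).trans h)))

/-- multivariate Faà di Bruno formula under the block-structure assumptions
of Lemma `FdbMultiStrong`. Mixed partial derivatives of order `n` (one derivative in each
of the `n` coordinates, in any order, encoded by a duplicate-free enumeration `L` of all
coordinates) of `f ∘ g` factor as stated. -/
theorem stmt14 (n m : ℕ) (hn : 1 ≤ n) (hm : 1 ≤ m)
    (f : ℝ → ℝ) (g : (Fin n → ℝ) → ℝ)
    (hf : ContDiff ℝ (⊤ : ℕ∞) f) (hg : ContDiff ℝ (⊤ : ℕ∞) g)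
    (B : Fin m → Finset (Fin n)) (d : Fin m → ℕ)
    (hBne : ∀ l, (B l).Nonempty)
    (hBdisj : ∀ i j : Fin m, i ≠ j → Disjoint (B i) (B j))
    (hBcover : ∀ i : Fin n, ∃ l, i ∈ B l)
    (hBcard : ∀ l, (B l).card = d l)
    (hmixed : ∀ i j : Fin m, i ≠ j → ∀ k1 ∈ B i, ∀ k2 ∈ B j, pdrv k1 (pdrv k2 g) = 0)
    (h1 : Fin m → ℝ → ℝ) (h2 : Fin m → (Fin n → ℝ) → ℝ)
    (hh1 : ∀ l, ContDiff ℝ (⊤ : ℕ∞) (h1 l)) (hh2 : ∀ l, ContDiff ℝ (⊤ : ℕ∞) (h2 l))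
    (hfact : ∀ l : Fin m, ∀ S : Finset (Fin n), S ⊆ B l → S.Nonempty →
      ∀ L : List (Fin n), L.Nodup → (∀ i, i ∈ L ↔ i ∈ S) →
        L.foldr pdrv g =
          fun x => iteratedDeriv S.card (h1 l) (h2 l x) * ∏ i ∈ S, pdrv i (h2 l) x)
    (L : List (Fin n)) (hL : L.Nodup) (hLall : ∀ i, i ∈ L)
    (x : Fin n → ℝ) :
    L.foldr pdrv (fun y => f (g y)) x =
      (∏ l, ∏ i ∈ B l, pdrv i (h2 l) x) *
        ∑ k ∈ Finset.Icc 1 n, iteratedDeriv k f (g x) *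
          ∑ j ∈ QIdx m d k, ∏ l,
            bellP (d l) (j l) (fun r => iteratedDeriv r (h1 l) (h2 l x)) := by
  choose p hp using hBcover
  have huniq : ∀ i l, i ∈ B l → p i = l := by
    intro i l hi
    by_contra hne
    exact Finset.disjoint_left.1 (hBdisj _ _ hne) (hp i) hi
  have hfg : ContDiff ℝ (⊤ : ℕ∞) fun y => f (g y) := hf.comp hg
  have hzero : ∀ S : Finset (Fin n), ∀ i ∈ S, ¬ S ⊆ B (p i) → auxD S g x = 0 := by
    intro S i hi hS
    obtain ⟨c, hcS, hc⟩ := Finset.not_subset.1 hS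
    have hci : c ≠ i := fun h => hc (h ▸ hp i)
    have hpc : p c ≠ p i := fun h => hc (h ▸ hp c)
    have e1 : insert i (insert c ((S.erase i).erase c)) = S := by
      rw [Finset.insert_erase (Finset.mem_erase.2 ⟨hci, hcS⟩), Finset.insert_erase hi]
    rw [← e1, aux_D_insert' i _ (by simp [hci.symm]) g hg,
      aux_D_insert' c _ (by simp) _ (aux_pdrv_smooth i g hg),
      hmixed (p c) (p i) hpc c (hp c) i (hp i), auxD, aux_foldr_zero]
    rfl
  have hfact' : ∀ l : Fin m, ∀ S : Finset (Fin n), S ⊆ B l → S.Nonempty →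
      auxD S g x = (fun r => iteratedDeriv r (h1 l) (h2 l x)) S.card *
        ∏ i ∈ S, pdrv i (h2 (p i)) x := by
    intro l S hS hne
    have := congrFun (hfact l S hS hne S.toList S.nodup_toList (by simp)) x
    rw [auxD, this]
    congr 1
    exact Finset.prod_congr rfl fun i hi => by rw [huniq i l (hS hi)]
  rw [aux_D_list L hL Finset.univ (by simpa using hLall) _ hfg,
    aux_main g hg B hBdisj p hp x (fun i => pdrv i (h2 (p i)) x)
      (fun l r => iteratedDeriv r (h1 l) (h2 l x)) hzero hfact' _ _ rfl f hf]
  have hd : ∀ l, 1 ≤ d l := fun l => hBcard l ▸ (hBne l).card_pos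
  have huniv : (Finset.univ : Finset (Fin n)) = Finset.univ.biUnion B := by
    ext i
    simpa using ⟨p i, hp i⟩
  have hsum : ∑ l, d l = n := by
    have h : (Finset.univ : Finset (Fin n)).card = ∑ l, (B l).card := by
      rw [huniv]
      exact Finset.card_biUnion fun i _ j _ hij => hBdisj i j hij
    simp only [hBcard, Finset.card_univ, Fintype.card_fin] at h
    exact h.symm
  congr 1
  · rw [huniv, Finset.prod_biUnion fun i _ j _ hij => hBdisj i j hij]
    exact Finset.prod_congr rfl fun l _ => Finset.prod_congr rfl fun i hi => by
      rw [huniq i l hi]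
  · have e1 : ∏ l, auxY (fun r => iteratedDeriv r (h1 l) (h2 l x)) (Finset.univ ∩ B l).card =
        ∑ j ∈ Fintype.piFinset fun l => Finset.Icc 1 (d l), Polynomial.monomial (∑ l, j l)
          (∏ l, bellP (d l) (j l) (fun r => iteratedDeriv r (h1 l) (h2 l x))) := by
      have : ∀ l, auxY (fun r => iteratedDeriv r (h1 l) (h2 l x)) (Finset.univ ∩ B l).card =
          ∑ k ∈ Finset.Icc 1 (d l), Polynomial.monomial k
            (bellP (d l) k (fun r => iteratedDeriv r (h1 l) (h2 l x))) := by
        intro l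
        rw [Finset.univ_inter, hBcard, aux_Y_eq _ _ (hd l)]
      simp only [this]
      rw [Finset.prod_univ_sum]
      refine Finset.sum_congr rfl fun j _ => ?_
      induction (Finset.univ : Finset (Fin m)) using Finset.induction_on with
      | empty => simp
      | insert a s ha ih =>
        rw [Finset.prod_insert ha, ih, Polynomial.monomial_mul_monomial, Finset.sum_insert ha,
          Finset.prod_insert ha]
    rw [e1, map_sum]
    simp only [aux_Ev_monomial]
    rw [← Finset.sum_fiberwise_of_maps_to (t := Finset.Icc 1 n) (g := fun j => ∑ l, j l)]
    · refine Finset.sum_congr rfl fun k _ => ?_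
      rw [Finset.mul_sum]
      refine Finset.sum_congr rfl fun j hj => ?_
      rw [(Finset.mem_filter.1 hj).2, mul_comm]
    · intro j hj
      simp only [Fintype.mem_piFinset, Finset.mem_Icc] at hj
      refine Finset.mem_Icc.2 ⟨?_, ?_⟩
      · have := Finset.single_le_sum (f := j) (fun _ _ => Nat.zero_le _)
          (Finset.mem_univ (⟨0, hm⟩ : Fin m))
        exact (hj ⟨0, hm⟩).1.trans this
      · rw [← hsum]
        exact Finset.sum_le_sum fun l _ => (hj l).2
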